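/- arXiv:1108.4840 — 4 statements merged into one kernel-verified Lean document; each statement's English description precedes it below -/
import Mathlib

section
/- Let p be an odd prime and let P, Q be integers with p ∤ PQ. Then, with congruences interpreted in ℤ/pℤ (denominators inverted mod p): (i) ∑_{k=0}^{⌊p/4⌋} C(4k,2k)·(P²/(64Q))^k ≡ (−Q)^{−⌊p/4⌋}·U_{(p+ε)/2}(P,Q) (mod p), where ε = (−1|p) is the Legendre symbol (so ε = (−1)^{(p−1)/2}); and (ii) ∑_{k=0}^{⌊p/4⌋} C(4k,2k)·(Q/(4P²))^k ≡ (P|p)·U_{(p+1)/2}(P,Q) (mod p), where (P|p) is the Legendre symbol. -/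
/-- The Lucas sequence `U_n(P,Q)`: `U_0 = 0`, `U_1 = 1`,
`U_{n+1} = P·U_n − Q·U_{n−1}`. -/
def lucasU (P Q : ℤ) : ℕ → ℤ
  | 0 => 0
  | 1 => 1
  | n + 2 => P * lucasU P Q (n + 1) - Q * lucasU P Q n

/-- For an odd prime `p = 2n + 1`, the central binomial coefficients satisfy
`C(2m,m) = (-4)^m C(n,m)` in characteristic `p`, in the range `m ≤ n`. -/
theorem centralBinom_cast_eq {K : Type*} [Field K] {p n : ℕ} [CharP K p]
    (hn : p = 2 * n + 1) {m : ℕ} (hm : m ≤ n) :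
    (Nat.centralBinom m : K) = (-4) ^ m * (n.choose m : K) := by
  induction m with
  | zero => simp
  | succ m ih =>
    have hm0 : ((m : K) + 1) ≠ 0 := by
      intro h0
      have h1 : ((m + 1 : ℕ) : K) = 0 := by exact_mod_cast h0
      rw [CharP.cast_eq_zero_iff K p] at h1
      have := Nat.le_of_dvd (Nat.succ_pos m) h1
      omega
    have hp0 : (2 * n + 1 : K) = 0 := by
      have := CharP.cast_eq_zero K p
      rw [congrArg (Nat.cast (R := K)) hn] at this
      exact_mod_cast this
    have h1 : ((m : K) + 1) * (Nat.centralBinom (m + 1) : K)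
        = 2 * (2 * m + 1) * (Nat.centralBinom m : K) := by
      exact_mod_cast congrArg (Nat.cast (R := K)) (Nat.succ_mul_centralBinom_succ m)
    have h2 : (n.choose (m + 1) : K) * (m + 1) = (n.choose m : K) * (n - m) := by
      have := congrArg (Nat.cast (R := K)) (Nat.choose_succ_right_eq n m)
      push_cast [Nat.cast_sub (show m ≤ n by omega)] at this
      exact this
    apply mul_left_cancel₀ hm0
    rw [h1, ih (by omega), pow_succ]
    linear_combination (4 * (-4) ^ m) * h2 + 2 * (-4) ^ m * (n.choose m : K) * hp0

theorem two_mul_sum_choose_even {R : Type*} [CommRing R] (z : R) (n : ℕ) :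
    2 * ∑ k ∈ Finset.range (n / 2 + 1), (n.choose (2 * k) : R) * (z ^ 2) ^ k
      = (1 + z) ^ n + (1 - z) ^ n := by
  have extend (w : R) : (1 + w) ^ n
      = ∑ i ∈ Finset.range (2 * (n / 2 + 1)), w ^ i * (n.choose i : R) := by
    rw [add_comm, add_pow]
    simp only [one_pow, mul_one]
    refine Finset.sum_subset (fun i hi => ?_) (fun i _ hi => ?_)
    · simp only [Finset.mem_range] at hi ⊢
      omega
    · rw [Nat.choose_eq_zero_of_lt (by simpa using hi)]
      simp
  have pair (f : ℕ → R) (m : ℕ) : ∑ i ∈ Finset.range (2 * m), f i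
      = ∑ k ∈ Finset.range m, (f (2 * k) + f (2 * k + 1)) := by
    induction m with
    | zero => simp
    | succ m ih => rw [Finset.sum_range_succ, ← ih, Nat.mul_succ, Finset.sum_range_succ,
        Finset.sum_range_succ, add_assoc]
  rw [sub_eq_add_neg, extend z, extend (-z), pair, pair, ← Finset.sum_add_distrib,
    Finset.mul_sum]
  refine Finset.sum_congr rfl fun k _ => ?_
  rw [pow_succ (-z), pow_mul (-z), neg_sq, pow_succ z, pow_mul z]
  ring

theorem lucasU_cast_succ_succ {R : Type*} [CommRing R] (P Q : ℤ) (m : ℕ) :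
    (lucasU P Q (m + 2) : R) = P * lucasU P Q (m + 1) - Q * lucasU P Q m := by
  simp [lucasU]

/-- If `s² = Q` in a field of characteristic `p = 2n + 1` in which `P ± 2s` are squares, then
`(P + 2s)^n = U_{n+1} - s U_n`. -/
theorem pow_add_two_mul_sqrt {K : Type*} [Field K] {p n : ℕ} [Fact p.Prime] [CharP K p]
    (hn : p = 2 * n + 1) (P Q : ℤ) {s u v : K} (hs : s ^ 2 = Q)
    (hu : u ^ 2 = P + 2 * s) (hv : v ^ 2 = P - 2 * s) :
    ((P : K) + 2 * s) ^ n = lucasU P Q (n + 1) - s * lucasU P Q n := by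
  have hp : p.Prime := Fact.out
  have hn0 : n ≠ 0 := by
    rintro rfl
    exact hp.one_lt.ne' hn
  have hp0 : (2 * n + 1 : K) = 0 := by
    have := CharP.cast_eq_zero K p
    rw [congrArg (Nat.cast (R := K)) hn] at this
    exact_mod_cast this
  have h2 : (2 : K) ≠ 0 := by
    intro h
    rw [h, zero_mul, zero_add] at hp0
    exact one_ne_zero hp0
  by_cases hu0 : u = 0
  · have hP : (P : K) = -2 * s := by linear_combination (-1 : K) * hu + u * hu0
    have key (m : ℕ) : (lucasU P Q m : K) * s = -m * (-s) ^ m ∧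
        (lucasU P Q (m + 1) : K) = (m + 1) * (-s) ^ m := by
      induction m with
      | zero => simp [lucasU]
      | succ m ih =>
        obtain ⟨h1, h2⟩ := ih
        refine ⟨by rw [h2, pow_succ]; push_cast; ring, ?_⟩
        rw [lucasU_cast_succ_succ, h2, hP, ← hs, pow_succ]
        push_cast
        linear_combination (-s) * h1
    obtain ⟨h1, h3⟩ := key n
    rw [h3, ← hu, hu0, zero_pow two_ne_zero, zero_pow hn0]
    linear_combination h1 - (-s) ^ n * hp0
  by_cases hv0 : v = 0
  · have hP : (P : K) = 2 * s := by linear_combination (-1 : K) * hv + v * hv0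
    have key (m : ℕ) : (lucasU P Q (m + 1) : K) - s * lucasU P Q m = s ^ m := by
      induction m with
      | zero => simp [lucasU]
      | succ m ih =>
        rw [lucasU_cast_succ_succ, hP, ← hs, pow_succ]
        linear_combination s * ih
    have h4 : (2 : K) ^ (2 * n) = 1 := by
      let f : ZMod p →+* K := ZMod.castHom dvd_rfl K
      have h2' : (2 : ZMod p) ≠ 0 := fun h => h2 (by rw [← map_ofNat f 2, h, map_zero])
      have hpow := ZMod.pow_card_sub_one_eq_one h2'
      rw [show p - 1 = 2 * n by omega] at hpow
      rw [← map_ofNat f 2, ← map_pow, hpow, map_one]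
    rw [key, hP, ← two_mul, ← mul_assoc, mul_pow, ← sq, ← pow_mul, h4, one_mul]
  obtain ⟨a, b, rfl, rfl⟩ : ∃ a b : K, a + b = u ∧ a - b = v :=
    ⟨(u + v) / 2, (u - v) / 2, by field_simp; ring, by field_simp; ring⟩
  have hP : (P : K) = a ^ 2 + b ^ 2 := by
    apply mul_left_cancel₀ h2
    linear_combination (-1 : K) * hu - hv
  have hab : s = a * b := by
    apply mul_left_cancel₀ (mul_ne_zero h2 h2)
    linear_combination hv - hu
  have key (m : ℕ) : (a + b) * (a - b) * (lucasU P Q m : K) = a ^ (2 * m) - b ^ (2 * m) ∧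
      (a + b) * (a - b) * (lucasU P Q (m + 1) : K)
        = a ^ (2 * (m + 1)) - b ^ (2 * (m + 1)) := by
    induction m with
    | zero => simp [lucasU]; ring
    | succ m ih =>
      obtain ⟨h1, h3⟩ := ih
      refine ⟨h3, ?_⟩
      rw [lucasU_cast_succ_succ, hP, ← hs, hab]
      linear_combination (a ^ 2 + b ^ 2) * h3 - (a * b) ^ 2 * h1
  obtain ⟨h1, h3⟩ := key n
  have hfrob : (a + b) ^ (2 * n + 1) = a ^ (2 * n + 1) + b ^ (2 * n + 1) := by
    simpa only [← hn] using add_pow_char a b (p := p)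
  apply mul_left_cancel₀ (mul_ne_zero hu0 hv0)
  rw [← hu, ← pow_mul, hab]
  linear_combination (a - b) * hfrob - h3 + a * b * h1

theorem two_mul_sum_choose_four_mul {K : Type*} [Field K] {p n : ℕ} [CharP K p]
    (hn : p = 2 * n + 1) {x z : K} (hx : 16 * x = z ^ 2) :
    2 * ∑ k ∈ Finset.range (n / 2 + 1), (Nat.choose (4 * k) (2 * k) : K) * x ^ k
      = (1 + z) ^ n + (1 - z) ^ n := by
  rw [← two_mul_sum_choose_even]
  congr 1
  refine Finset.sum_congr rfl fun k hk => ?_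
  have hk' : 2 * k ≤ n := by
    have := Finset.mem_range.mp hk
    omega
  have h := centralBinom_cast_eq (K := K) hn hk'
  rw [Nat.centralBinom, ← mul_assoc, show 2 * 2 = 4 from rfl] at h
  rw [← hx, mul_pow, h, pow_mul]
  norm_num
  ring

/-- Two consecutive Lucas numbers at half of the characteristic, in terms of a square root `s`
of `Q`. -/
theorem exists_sqrt_lucasU {K : Type*} [Field K] [IsAlgClosed K] {p n : ℕ} [Fact p.Prime]
    [CharP K p] (hn : p = 2 * n + 1) (P Q : ℤ) :
    ∃ s : K, s ^ 2 = Q ∧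
      (P + 2 * s) ^ n + (P - 2 * s) ^ n = 2 * (lucasU P Q (n + 1) : K) ∧
      (P + 2 * s) ^ n - (P - 2 * s) ^ n = -2 * s * (lucasU P Q n : K) := by
  obtain ⟨s, hs⟩ := IsAlgClosed.exists_pow_nat_eq (Q : K) two_pos
  obtain ⟨u, hu⟩ := IsAlgClosed.exists_pow_nat_eq ((P : K) + 2 * s) two_pos
  obtain ⟨v, hv⟩ := IsAlgClosed.exists_pow_nat_eq ((P : K) - 2 * s) two_pos
  have h1 := pow_add_two_mul_sqrt hn P Q hs hu hv
  have h2 := pow_add_two_mul_sqrt hn P Q (s := -s) (by rw [neg_sq, hs])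
    (by rw [hv]; ring) (by rw [hu]; ring)
  rw [mul_neg, ← sub_eq_add_neg] at h2
  exact ⟨s, hs, by rw [h1, h2]; ring, by rw [h1, h2]; ring⟩

theorem sum_choose_four_mul_div_right {K : Type*} [Field K] [IsAlgClosed K] {p n : ℕ}
    [Fact p.Prime] [CharP K p] (hn : p = 2 * n + 1) (h2 : (2 : K) ≠ 0) {P : ℤ} (Q : ℤ)
    (hP : (P : K) ≠ 0) :
    (P : K) ^ n * ∑ k ∈ Finset.range (n / 2 + 1),
        (Nat.choose (4 * k) (2 * k) : K) * ((Q : K) / (4 * (P : K) ^ 2)) ^ k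
      = lucasU P Q (n + 1) := by
  obtain ⟨s, hs, hadd, -⟩ := exists_sqrt_lucasU (K := K) hn P Q
  have h4 : (4 : K) = 2 * 2 := by norm_num
  apply mul_left_cancel₀ h2
  rw [mul_left_comm, two_mul_sum_choose_four_mul hn (z := 2 * s / P)
    (by rw [← hs, h4]; field_simp; ring), ← hadd, mul_add, ← mul_pow, ← mul_pow]
  congr 2 <;> field_simp

theorem sum_choose_four_mul_div_left {K : Type*} [Field K] [IsAlgClosed K] {p n : ℕ}
    [Fact p.Prime] [CharP K p] (hn : p = 2 * n + 1) (h2 : (2 : K) ≠ 0) (P : ℤ) {Q : ℤ}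
    (hQ : (Q : K) ≠ 0) :
    (2 : K) ^ n * (Q : K) ^ (n / 2) * ∑ k ∈ Finset.range (n / 2 + 1),
        (Nat.choose (4 * k) (2 * k) : K) * ((P : K) ^ 2 / (64 * (Q : K))) ^ k
      = if n % 2 = 0 then (lucasU P Q (n + 1) : K) else -lucasU P Q n := by
  obtain ⟨s, hs, hadd, hsub⟩ := exists_sqrt_lucasU (K := K) hn P Q
  have hs0 : s ≠ 0 := by
    rintro rfl
    exact hQ (by rw [← hs]; simp)
  have h16 : (16 : K) = 2 ^ 4 := by norm_num
  have h64 : (64 : K) = 2 ^ 6 := by norm_num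
  have key := two_mul_sum_choose_four_mul (K := K) hn (x := P ^ 2 / (64 * Q))
    (z := P / (2 * s)) (by rw [← hs, h16, h64]; field_simp)
  set S := ∑ k ∈ Finset.range (n / 2 + 1),
        (Nat.choose (4 * k) (2 * k) : K) * ((P : K) ^ 2 / (64 * (Q : K))) ^ k
  have e1 : 2 * s * (1 + P / (2 * s)) = P + 2 * s := by field_simp; ring
  have e2 : 2 * s * (1 - P / (2 * s)) = -(P - 2 * s) := by field_simp; ring
  have key' : (2 * s) ^ n * (2 * S) = (P + 2 * s) ^ n + (-1) ^ n * (P - 2 * s) ^ n := by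
    rw [key, mul_add, ← mul_pow, ← mul_pow, e1, e2, neg_pow]
  rcases Nat.even_or_odd' n with ⟨m, hm | hm⟩
  · rw [if_pos (by omega), show n / 2 = m by omega, ← hs, ← pow_mul, ← hm, ← mul_pow]
    apply mul_left_cancel₀ h2
    rw [← hadd, mul_left_comm, key', (show Even n by simp [hm]).neg_one_pow, one_mul]
  · rw [if_neg (by omega), show n / 2 = m by omega, ← hs, ← pow_mul]
    apply mul_left_cancel₀ (mul_ne_zero h2 hs0)
    rw [(show Odd n by simp [hm]).neg_one_pow, neg_one_mul, ← sub_eq_add_neg, hsub, mul_pow,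
      show s ^ n = s ^ (2 * m) * s by rw [← pow_succ, hm]] at key'
    linear_combination key'

theorem stmt0 (p : ℕ) [Fact p.Prime] (hp : p ≠ 2) (P Q : ℤ)
    (h : ¬ (p : ℤ) ∣ P * Q) :
    ((∑ k ∈ Finset.range (p / 4 + 1),
        (Nat.choose (4 * k) (2 * k) : ZMod p) *
          ((P : ZMod p) ^ 2 / (64 * (Q : ZMod p))) ^ k)
      = ((-(Q : ZMod p)) ^ (p / 4))⁻¹ *
          (lucasU P Q (((p : ℤ) + legendreSym p (-1)).toNat / 2) : ZMod p)) ∧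
    ((∑ k ∈ Finset.range (p / 4 + 1),
        (Nat.choose (4 * k) (2 * k) : ZMod p) *
          ((Q : ZMod p) / (4 * (P : ZMod p) ^ 2)) ^ k)
      = (legendreSym p P : ZMod p) * (lucasU P Q ((p + 1) / 2) : ZMod p)) := by
  have hprime : p.Prime := Fact.out
  obtain ⟨n, hn⟩ : ∃ n, p = 2 * n + 1 := hprime.odd_of_ne_two hp
  let f : ZMod p →+* AlgebraicClosure (ZMod p) := algebraMap _ _
  have : CharP (AlgebraicClosure (ZMod p)) p :=
    charP_of_injective_algebraMap (algebraMap (ZMod p) _).injective p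
  have h2 : (2 : ZMod p) ≠ 0 := by
    intro h0
    have : ((2 : ℕ) : ZMod p) = 0 := by exact_mod_cast h0
    rw [ZMod.natCast_eq_zero_iff] at this
    exact hp ((Nat.prime_dvd_prime_iff_eq hprime Nat.prime_two).mp this)
  have h2f : (2 : AlgebraicClosure (ZMod p)) ≠ 0 := by
    rw [← map_ofNat f 2]
    exact (map_ne_zero f).mpr h2
  have hPQ : (P : ZMod p) * Q ≠ 0 := by
    rwa [← Int.cast_mul, Ne, ZMod.intCast_zmod_eq_zero_iff_dvd]
  have hP := left_ne_zero_of_mul hPQ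
  have hQ := right_ne_zero_of_mul hPQ
  have hPf : (P : AlgebraicClosure (ZMod p)) ≠ 0 := by
    rw [← map_intCast f]
    exact (map_ne_zero f).mpr hP
  have hQf : (Q : AlgebraicClosure (ZMod p)) ≠ 0 := by
    rw [← map_intCast f]
    exact (map_ne_zero f).mpr hQ
  have hp2 : p / 2 = n := by omega
  rw [show p / 4 = n / 2 by omega]
  constructor
  · have hleft : (2 : ZMod p) ^ n * (Q : ZMod p) ^ (n / 2) *
        ∑ k ∈ Finset.range (n / 2 + 1),
          (Nat.choose (4 * k) (2 * k) : ZMod p) * ((P : ZMod p) ^ 2 / (64 * (Q : ZMod p))) ^ k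
        = if n % 2 = 0 then (lucasU P Q (n + 1) : ZMod p) else -lucasU P Q n := by
      apply f.injective
      have := sum_choose_four_mul_div_left hn h2f P hQf
      rw [apply_ite f]
      simpa only [map_mul, map_pow, map_div₀, map_intCast, map_natCast, map_ofNat, map_sum,
        map_neg] using this
    have h2n := legendreSym.eq_pow p 2
    rw [hp2, legendreSym.at_two hp, ZMod.χ₈_nat_eq_if_mod_eight, if_neg (by omega),
      Int.cast_ofNat] at h2n
    rw [eq_inv_mul_iff_mul_eq₀ (pow_ne_zero _ (neg_ne_zero.mpr hQ)), legendreSym.at_neg_one hp,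
      ZMod.χ₄_nat_eq_if_mod_four, if_neg (by omega), neg_pow]
    rcases Nat.even_or_odd' n with ⟨m, hm | hm⟩
    · rw [if_pos (by omega), ← h2n] at hleft
      rw [if_pos (by omega), show ((p : ℤ) + 1).toNat / 2 = n + 1 by omega, ← hleft]
      congr 2
      rcases Nat.even_or_odd' m with ⟨l, hl | hl⟩
      · rw [if_pos (by omega), show n / 2 = 2 * l by omega]
        simp
      · rw [if_neg (by omega), show n / 2 = 2 * l + 1 by omega]
        simp [pow_succ]
    · rw [if_neg (by omega), ← h2n] at hleft
      rw [if_neg (by omega), show ((p : ℤ) + -1).toNat / 2 = n by omega,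
        ← neg_neg (lucasU P Q n : ZMod p), ← hleft, ← neg_mul, ← neg_mul]
      congr 2
      rcases Nat.even_or_odd' m with ⟨l, hl | hl⟩
      · rw [if_neg (by omega), show n / 2 = 2 * l by omega]
        simp
      · rw [if_pos (by omega), show n / 2 = 2 * l + 1 by omega]
        simp [pow_succ]
  · have hright : (P : ZMod p) ^ n * ∑ k ∈ Finset.range (n / 2 + 1),
          (Nat.choose (4 * k) (2 * k) : ZMod p) * ((Q : ZMod p) / (4 * (P : ZMod p) ^ 2)) ^ k
        = lucasU P Q (n + 1) := by
      apply f.injective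
      have := sum_choose_four_mul_div_right hn h2f Q hPf
      simpa only [map_mul, map_pow, map_div₀, map_intCast, map_natCast, map_ofNat, map_sum]
        using this
    have hsq : (legendreSym p P : ZMod p) * legendreSym p P = 1 := by
      exact_mod_cast congrArg (Int.cast (R := ZMod p)) ((sq _).symm.trans
        (legendreSym.sq_one p hP))
    rw [show (p + 1) / 2 = n + 1 by omega, ← hright, ← hp2, ← legendreSym.eq_pow, ← mul_assoc,
      hsq, one_mul]
end

section
/- Let p be an odd prime and let x be an integer with x ≢ 0 (mod p) and x ≢ 1 (mod p). Then, with congruences interpreted in ℤ/pℤ: (i) if p ≡ 1 (mod 4), then ∑_{k=0}^{⌊p/4⌋} C(4k,2k)·(x/16)^k ≡ x^{(p−1)/4}·∑_{k=0}^{⌊p/4⌋} C(4k,2k)/(16x)^k (mod p); (ii) if p ≡ 3 (mod 4), then ∑_{k=0}^{⌊p/4⌋} C(4k,2k)/(16x)^k ≡ (1 − 1/x)^{(p−3)/4}·∑_{k=0}^{⌊p/4⌋} C(4k,2k)/(16(1−x))^k (mod p). -/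
open Polynomial in
/-- For odd `n = 2 * m + 1`, the polynomial `∑ k, C(n, 2k) X ^ (m - k)`. -/
noncomputable def evenBinomialPoly (R : Type*) [CommRing R] (m : ℕ) : R[X] :=
  ∑ k ∈ Finset.range (m + 1), C ((Nat.choose (2 * m + 1) (2 * k) : ℕ) : R) * X ^ (m - k)

theorem sum_range_two_mul_eq {M : Type*} [AddCommMonoid M] (f : ℕ → M) (N : ℕ) :
    ∑ i ∈ Finset.range (2 * N), f i
      = ∑ k ∈ Finset.range N, (f (2 * k) + f (2 * k + 1)) := by
  induction N with
  | zero => simp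
  | succ N ih =>
    rw [show 2 * (N + 1) = 2 * N + 1 + 1 by ring, Finset.sum_range_succ, Finset.sum_range_succ,
      ih, Finset.sum_range_succ, add_assoc]

theorem add_one_pow_add_sub_one_pow {R : Type*} [CommRing R] (y : R) (m : ℕ) :
    (y + 1) ^ (2 * m + 1) + (y - 1) ^ (2 * m + 1)
      = 2 * y * ∑ k ∈ Finset.range (m + 1),
          (Nat.choose (2 * m + 1) (2 * k) : R) * (y ^ 2) ^ (m - k) := by
  rw [add_comm y 1, sub_eq_neg_add, add_pow, add_pow, ← Finset.sum_add_distrib,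
    show 2 * m + 1 + 1 = 2 * (m + 1) by ring, sum_range_two_mul_eq, Finset.mul_sum]
  refine Finset.sum_congr rfl fun k hk => ?_
  have hk : k ≤ m := Nat.lt_succ_iff.mp (Finset.mem_range.mp hk)
  rw [show 2 * m + 1 - 2 * k = 2 * (m - k) + 1 by omega, pow_succ y, pow_mul y, pow_succ (-1),
    pow_mul (-1)]
  simp only [one_pow, neg_one_sq]
  ring

theorem evenBinomialPoly_natDegree_le (R : Type*) [CommRing R] (m : ℕ) :
    (evenBinomialPoly R m).natDegree ≤ m := by
  refine Polynomial.natDegree_sum_le_of_forall_le _ _ fun k _ => ?_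
  exact (Polynomial.natDegree_C_mul_X_pow_le _ _).trans (Nat.sub_le _ _)

theorem evenBinomialPoly_coeff_self (R : Type*) [CommRing R] (m : ℕ) :
    (evenBinomialPoly R m).coeff m = 1 := by
  rw [evenBinomialPoly, Polynomial.finsetSum_coeff, Finset.sum_eq_single 0]
  · simp
  · intro k hk hk0
    have := Finset.mem_range.mp hk
    rw [Polynomial.coeff_C_mul_X_pow, if_neg (by omega)]
  · simp

theorem evenBinomialPoly_natDegree (R : Type*) [CommRing R] [Nontrivial R] (m : ℕ) :
    (evenBinomialPoly R m).natDegree = m :=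
  Polynomial.natDegree_eq_of_le_of_coeff_ne_zero (evenBinomialPoly_natDegree_le R m)
    (by rw [evenBinomialPoly_coeff_self]; exact one_ne_zero)

theorem evenBinomialPoly_monic (R : Type*) [CommRing R] [Nontrivial R] (m : ℕ) :
    (evenBinomialPoly R m).Monic := by
  rw [Polynomial.Monic, Polynomial.leadingCoeff, evenBinomialPoly_natDegree,
    evenBinomialPoly_coeff_self]

theorem ZMod.two_ne_zero_of_prime_ne_two (p : ℕ) [Fact p.Prime] (hp : p ≠ 2) :
    (2 : ZMod p) ≠ 0 :=
  Ring.two_ne_zero (by rwa [ZMod.ringChar_zmod_n])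

open Polynomial in
theorem evenBinomialPoly_sq (p m : ℕ) [Fact p.Prime] (hp : p = 4 * m + 3) :
    2 * X * (X - 1) * evenBinomialPoly (ZMod p) m ^ 2
      = X ^ (2 * m + 2) + (1 - X) ^ (2 * m + 2) - 1 := by
  have h2 : (2 : (ZMod p)[X]) ≠ 0 :=
    C_ne_zero.mpr (ZMod.two_ne_zero_of_prime_ne_two p (by omega))
  have hexp : expand (ZMod p) 2 (evenBinomialPoly (ZMod p) m)
      = ∑ k ∈ Finset.range (m + 1),
          (Nat.choose (2 * m + 1) (2 * k) : (ZMod p)[X]) * (X ^ 2) ^ (m - k) := by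
    simp [evenBinomialPoly, map_sum]
  have key := add_one_pow_add_sub_one_pow (X : (ZMod p)[X]) m
  rw [← hexp] at key
  apply expand_injective (R := ZMod p) two_pos
  simp only [map_mul, map_sub, map_add, map_pow, map_ofNat, expand_X, map_one]
  have fa : (X + 1 : (ZMod p)[X]) ^ (4 * m + 3) = X ^ (4 * m + 3) + 1 := by
    have := add_pow_char (X : (ZMod p)[X]) 1 p
    rwa [one_pow, congrArg (HPow.hPow (X + 1 : (ZMod p)[X])) hp,
      congrArg (HPow.hPow (X : (ZMod p)[X])) hp] at this
  have fs : (X - 1 : (ZMod p)[X]) ^ (4 * m + 3) = X ^ (4 * m + 3) - 1 := by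
    have := sub_pow_char (R := (ZMod p)[X]) (p := p) X 1
    rwa [one_pow, congrArg (HPow.hPow (X - 1 : (ZMod p)[X])) hp,
      congrArg (HPow.hPow (X : (ZMod p)[X])) hp] at this
  apply mul_left_cancel₀ h2
  set E := expand (ZMod p) 2 (evenBinomialPoly (ZMod p) m)
  have e1 : (1 - X ^ 2 : (ZMod p)[X]) ^ (2 * m + 2)
      = (X + 1) ^ (2 * m + 2) * (X - 1) ^ (2 * m + 2) := by
    rw [← mul_pow, show (1 - X ^ 2 : (ZMod p)[X]) = -((X + 1) * (X - 1)) by ring,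
      Even.neg_pow ⟨m + 1, by ring⟩]
  rw [e1]
  calc 2 * (2 * X ^ 2 * (X ^ 2 - 1) * E ^ 2)
      = (X ^ 2 - 1) * (2 * X * E) ^ 2 := by ring
    _ = (X - 1) * (X + 1) ^ (4 * m + 3) + (X + 1) * (X - 1) ^ (4 * m + 3)
        + 2 * ((X + 1) ^ (2 * m + 2) * (X - 1) ^ (2 * m + 2)) := by
      rw [← key]
      generalize hu : (X + 1 : (ZMod p)[X]) = u
      generalize hv : (X - 1 : (ZMod p)[X]) = v
      rw [show (X ^ 2 - 1 : (ZMod p)[X]) = u * v by rw [← hu, ← hv]; ring]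
      ring
    _ = _ := by rw [fa, fs]; ring

open Polynomial in
theorem evenBinomialPoly_comp_one_sub (p m : ℕ) [Fact p.Prime] (hp : p = 4 * m + 3) :
    (evenBinomialPoly (ZMod p) m).comp (1 - X) = (-1) ^ m * evenBinomialPoly (ZMod p) m := by
  have h2 : (2 : (ZMod p)[X]) ≠ 0 :=
    C_ne_zero.mpr (ZMod.two_ne_zero_of_prime_ne_two p (by omega))
  set g := evenBinomialPoly (ZMod p) m with hg
  have sq := evenBinomialPoly_sq p m hp
  rw [← hg] at sq
  have sq' := congrArg (fun q => q.comp (1 - X)) sq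
  simp only [mul_comp, sub_comp, add_comp, pow_comp, X_comp, one_comp, ofNat_comp] at sq'
  have hX1 : (X - 1 : (ZMod p)[X]) ≠ 0 := by simpa using X_sub_C_ne_zero (1 : ZMod p)
  have hsq : (g.comp (1 - X)) ^ 2 = g ^ 2 := by
    apply mul_left_cancel₀ (mul_ne_zero (mul_ne_zero h2 X_ne_zero) hX1)
    rw [sq]
    rw [sub_sub_cancel] at sq'
    linear_combination sq'
  have hlin : (1 - X : (ZMod p)[X]) = C (-1) * X + C 1 := by simp; ring
  have hlc : (g.comp (1 - X)).leadingCoeff = (-1) ^ m := by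
    rw [leadingCoeff_comp, evenBinomialPoly_natDegree, (evenBinomialPoly_monic _ m).leadingCoeff,
      hlin, leadingCoeff_linear (by simp), one_mul]
    rw [hlin, natDegree_linear (by simp)]
    exact one_ne_zero
  have hg1 : g.leadingCoeff = 1 := evenBinomialPoly_monic _ m
  have hC : ((-1) ^ m : (ZMod p)[X]) = C ((-1) ^ m) := by simp
  rcases sq_eq_sq_iff_eq_or_eq_neg.mp hsq with h | h
  · rw [h, hg1] at hlc
    rw [h, hC, ← hlc, C_1, one_mul]
  · rw [h, leadingCoeff_neg, hg1] at hlc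
    rw [h, hC, ← hlc, C_neg, C_1, neg_one_mul]

theorem choose_two_mul_self_eq (p n k : ℕ) [Fact p.Prime] (hp : p = 2 * n + 1) (hk : k ≤ n) :
    (Nat.choose (2 * k) k : ZMod p) = (-4) ^ k * (Nat.choose n k : ZMod p) := by
  induction k with
  | zero => simp
  | succ k ih =>
    have hk0 : ((k + 1 : ℕ) : ZMod p) ≠ 0 := by
      rw [Ne, ZMod.natCast_eq_zero_iff]
      exact fun h => by have := Nat.le_of_dvd k.succ_pos h; omega
    apply mul_left_cancel₀ hk0
    have h1 := congrArg (Nat.cast : ℕ → ZMod p) (Nat.succ_mul_centralBinom_succ k)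
    have h2 := congrArg (Nat.cast : ℕ → ZMod p) (Nat.choose_succ_right_eq n k)
    have h3 : (2 * n + 1 : ZMod p) = 0 := by
      have := congrArg (Nat.cast : ℕ → ZMod p) hp
      rw [ZMod.natCast_self] at this
      exact_mod_cast this.symm
    rw [Nat.centralBinom, Nat.centralBinom] at h1
    push_cast [Nat.cast_sub (Nat.le_of_succ_le hk)] at h1 h2 ⊢
    rw [ih (Nat.le_of_succ_le hk)] at h1
    linear_combination h1 - (-4) ^ (k + 1) * h2 + 2 * (-4) ^ k * (n.choose k : ZMod p) * h3

theorem choose_four_mul_two_mul_eq (p n k : ℕ) [Fact p.Prime] (hp : p = 2 * n + 1)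
    (hk : 2 * k ≤ n) :
    (Nat.choose (4 * k) (2 * k) : ZMod p) = 16 ^ k * (Nat.choose n (2 * k) : ZMod p) := by
  have := choose_two_mul_self_eq p n (2 * k) hp hk
  rw [← mul_assoc, pow_mul] at this
  norm_num at this
  exact this

theorem sum_choose_four_mul_mul_pow (p n : ℕ) [Fact p.Prime] (hp : p = 2 * n + 1)
    (y : ZMod p) :
    ∑ k ∈ Finset.range (p / 4 + 1), (Nat.choose (4 * k) (2 * k) : ZMod p) * (y / 16) ^ k
      = ∑ k ∈ Finset.range (n / 2 + 1), (Nat.choose n (2 * k) : ZMod p) * y ^ k := by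
  have h16 : (16 : ZMod p) ≠ 0 := by
    rw [show (16 : ZMod p) = 2 ^ 4 by norm_num]
    exact pow_ne_zero _ (ZMod.two_ne_zero_of_prime_ne_two p (by omega))
  rw [show p / 4 = n / 2 by omega]
  refine Finset.sum_congr rfl fun k hk => ?_
  have := Finset.mem_range.mp hk
  rw [choose_four_mul_two_mul_eq p n k hp (by omega), div_pow]
  have := pow_ne_zero k h16
  field_simp

theorem sum_choose_four_mul_div_pow (p n : ℕ) [Fact p.Prime] (hp : p = 2 * n + 1)
    (y : ZMod p) :
    ∑ k ∈ Finset.range (p / 4 + 1), (Nat.choose (4 * k) (2 * k) : ZMod p) / (16 * y) ^ k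
      = ∑ k ∈ Finset.range (n / 2 + 1), (Nat.choose n (2 * k) : ZMod p) * (y⁻¹) ^ k := by
  rw [← sum_choose_four_mul_mul_pow p n hp]
  refine Finset.sum_congr rfl fun k _ => ?_
  rw [div_eq_mul_inv, ← inv_pow, mul_inv, div_eq_mul_inv, mul_comm (16⁻¹ : ZMod p)]

theorem eval_evenBinomialPoly {K : Type*} [Field K] (m : ℕ) {y : K} (hy : y ≠ 0) :
    (evenBinomialPoly K m).eval y
      = y ^ m * ∑ k ∈ Finset.range (m + 1),
          (Nat.choose (2 * m + 1) (2 * k) : K) * (y⁻¹) ^ k := by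
  rw [evenBinomialPoly, Polynomial.eval_finsetSum, Finset.mul_sum]
  refine Finset.sum_congr rfl fun k hk => ?_
  rw [Polynomial.eval_mul, Polynomial.eval_C, Polynomial.eval_pow, Polynomial.eval_X,
    pow_sub₀ y hy (Nat.lt_succ_iff.mp (Finset.mem_range.mp hk)), inv_pow]
  ring


theorem stmt2 (p : ℕ) [Fact p.Prime] (hp : p ≠ 2) (x : ℤ)
    (hx0 : (x : ZMod p) ≠ 0) (hx1 : (x : ZMod p) ≠ 1) :
    (p % 4 = 1 →
      (∑ k ∈ Finset.range (p / 4 + 1),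
          (Nat.choose (4 * k) (2 * k) : ZMod p) * ((x : ZMod p) / 16) ^ k)
        = (x : ZMod p) ^ ((p - 1) / 4) *
            ∑ k ∈ Finset.range (p / 4 + 1),
              (Nat.choose (4 * k) (2 * k) : ZMod p) / (16 * (x : ZMod p)) ^ k) ∧
    (p % 4 = 3 →
      (∑ k ∈ Finset.range (p / 4 + 1),
          (Nat.choose (4 * k) (2 * k) : ZMod p) / (16 * (x : ZMod p)) ^ k)
        = (1 - 1 / (x : ZMod p)) ^ ((p - 3) / 4) *
            ∑ k ∈ Finset.range (p / 4 + 1),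
              (Nat.choose (4 * k) (2 * k) : ZMod p) / (16 * (1 - (x : ZMod p))) ^ k) := by
  refine ⟨fun h => ?_, fun h => ?_⟩
  · obtain ⟨m, hm⟩ : ∃ m, p = 2 * (2 * m) + 1 := ⟨p / 4, by omega⟩
    rw [sum_choose_four_mul_mul_pow p _ hm, sum_choose_four_mul_div_pow p _ hm,
      show (p - 1) / 4 = m by omega, Nat.mul_div_cancel_left m two_pos, Finset.mul_sum,
      ← Finset.sum_range_reflect]
    refine Finset.sum_congr rfl fun k hk => ?_
    have hk : k ≤ m := Nat.lt_succ_iff.mp (Finset.mem_range.mp hk)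
    rw [Nat.add_sub_cancel, Nat.mul_sub, Nat.choose_symm (by omega), pow_sub₀ _ hx0 hk, inv_pow]
    ring
  · obtain ⟨m, hm⟩ : ∃ m, p = 2 * (2 * m + 1) + 1 := ⟨p / 4, by omega⟩
    have hx1' : 1 - (x : ZMod p) ≠ 0 := sub_ne_zero.mpr (Ne.symm hx1)
    rw [sum_choose_four_mul_div_pow p _ hm, sum_choose_four_mul_div_pow p _ hm,
      show (p - 3) / 4 = m by omega, show (2 * m + 1) / 2 = m by omega]
    have key := congrArg (Polynomial.eval (x : ZMod p))
      (evenBinomialPoly_comp_one_sub p m (by omega))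
    simp only [Polynomial.eval_comp, Polynomial.eval_sub, Polynomial.eval_one, Polynomial.eval_X,
      Polynomial.eval_mul, Polynomial.eval_pow, Polynomial.eval_neg] at key
    rw [eval_evenBinomialPoly m hx0, eval_evenBinomialPoly m hx1', ← mul_assoc, ← mul_pow] at key
    have e : 1 - 1 / (x : ZMod p) = (-(x : ZMod p))⁻¹ * (1 - x) := by
      field_simp
      ring
    rw [e, mul_pow, mul_assoc, key, neg_one_mul, ← mul_assoc, ← mul_pow,
      inv_mul_cancel₀ (neg_ne_zero.mpr hx0), one_pow, one_mul]
end

section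
/- Let p > 5 be a prime. Then, with congruences interpreted in ℤ/pℤ: ∑_{k=0}^{⌊p/4⌋} C(4k,2k)/(−16)^k ≡ (−1)^{(p−1)/8}·2^{(p−1)/4} (mod p) if p ≡ 1 (mod 8); ≡ (−1)^{(p−3)/8}·2^{(p−3)/4} (mod p) if p ≡ 3 (mod 8); ≡ 0 (mod p) if p ≡ 5 (mod 8); and ≡ (−1)^{(p+1)/8}·2^{(p−3)/4} (mod p) if p ≡ 7 (mod 8). -/
/-- Modulo an odd prime `2 * n + 1`, the central binomial coefficients agree with the
coefficients `(n.choose m) * (-4) ^ m`. -/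
lemma centralBinom_eq_choose_mul_neg_four_pow {p n : ℕ} [Fact p.Prime] (hpn : p = 2 * n + 1)
    (m : ℕ) (hm : m ≤ n) :
    (Nat.centralBinom m : ZMod p) = (n.choose m : ZMod p) * (-4) ^ m := by
  induction m with
  | zero => simp
  | succ m ih =>
    have hm' : m ≤ n := by omega
    have hp0 : (2 : ZMod p) * n + 1 = 0 := by
      have h : ((2 * n + 1 : ℕ) : ZMod p) = 0 := by rw [← hpn]; exact ZMod.natCast_self p
      exact_mod_cast h
    have hne : ((m + 1 : ℕ) : ZMod p) ≠ 0 := by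
      rw [Ne, ZMod.natCast_eq_zero_iff]
      intro h
      have := Nat.le_of_dvd (Nat.succ_pos m) h
      omega
    have h₁ := congrArg (Nat.cast : ℕ → ZMod p) (Nat.succ_mul_centralBinom_succ m)
    have h₂ := congrArg (Nat.cast : ℕ → ZMod p) (Nat.choose_succ_right_eq n m)
    push_cast [Nat.cast_sub hm'] at h₁ h₂ hne
    rw [ih hm'] at h₁
    apply mul_left_cancel₀ hne
    rw [pow_succ]
    linear_combination h₁ + 4 * (-4 : ZMod p) ^ m * h₂ + 2 * (n.choose m) * (-4) ^ m * hp0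

section AlternatingChoose

variable {R : Type*} [CommRing R]

lemma sum_choose_odd_succ (n N : ℕ) :
    ∑ k ∈ Finset.range N, ((n + 1).choose (2 * k + 1) : R) * (-1) ^ k =
      ∑ k ∈ Finset.range N, (n.choose (2 * k) : R) * (-1) ^ k +
        ∑ k ∈ Finset.range N, (n.choose (2 * k + 1) : R) * (-1) ^ k := by
  rw [← Finset.sum_add_distrib]
  refine Finset.sum_congr rfl fun k _ => ?_
  rw [Nat.choose_succ_succ]
  push_cast
  ring

lemma sum_choose_even_succ {n N : ℕ} (h : n ≤ 2 * N) :
    ∑ k ∈ Finset.range (N + 1), ((n + 1).choose (2 * k) : R) * (-1) ^ k =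
      ∑ k ∈ Finset.range (N + 1), (n.choose (2 * k) : R) * (-1) ^ k -
        ∑ k ∈ Finset.range (N + 1), (n.choose (2 * k + 1) : R) * (-1) ^ k := by
  rw [Finset.sum_range_succ' _ N, Finset.sum_range_succ' _ N,
    Finset.sum_range_succ (fun k => (n.choose (2 * k + 1) : R) * (-1) ^ k) N,
    Nat.choose_eq_zero_of_lt (show n < 2 * N + 1 by omega)]
  have : ∀ k, ((n + 1).choose (2 * (k + 1)) : R) * (-1) ^ (k + 1) =
      (n.choose (2 * (k + 1)) : R) * (-1) ^ (k + 1) - (n.choose (2 * k + 1) : R) * (-1) ^ k := by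
    intro k
    rw [show 2 * (k + 1) = (2 * k + 1) + 1 by ring, Nat.choose_succ_succ]
    push_cast
    ring
  simp only [this, Finset.sum_sub_distrib]
  simp
  ring

/-- If `a` and `b` are the real and imaginary parts of `(1 + i) ^ n`, then `a - b` and `a + b`
are those of `(1 + i) ^ (n + 1)`. -/
lemma sum_choose_succ {n N : ℕ} {a b : R} (h : n ≤ 2 * N)
    (hA : ∑ k ∈ Finset.range (N + 1), (n.choose (2 * k) : R) * (-1) ^ k = a)
    (hB : ∑ k ∈ Finset.range (N + 1), (n.choose (2 * k + 1) : R) * (-1) ^ k = b) :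
    ∑ k ∈ Finset.range (N + 1), ((n + 1).choose (2 * k) : R) * (-1) ^ k = a - b ∧
      ∑ k ∈ Finset.range (N + 1), ((n + 1).choose (2 * k + 1) : R) * (-1) ^ k = a + b := by
  rw [sum_choose_even_succ h, sum_choose_odd_succ, hA, hB]
  exact ⟨rfl, rfl⟩

/-- The real and imaginary parts of `(1 + i) ^ (4 * m) = (-4) ^ m`. -/
lemma sum_choose_four_mul (m N : ℕ) (h : 4 * m ≤ 2 * N + 1) :
    ∑ k ∈ Finset.range (N + 1), ((4 * m).choose (2 * k) : R) * (-1) ^ k = (-4) ^ m ∧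
      ∑ k ∈ Finset.range (N + 1), ((4 * m).choose (2 * k + 1) : R) * (-1) ^ k = 0 := by
  induction m with
  | zero =>
    constructor
    · rw [Finset.sum_range_succ']
      simp [Nat.choose_eq_zero_of_lt]
    · simp
  | succ m ih =>
    obtain ⟨hA, hB⟩ := ih (by omega)
    obtain ⟨hA₁, hB₁⟩ := sum_choose_succ (n := 4 * m) (by omega) hA hB
    obtain ⟨hA₂, hB₂⟩ := sum_choose_succ (by omega) hA₁ hB₁
    obtain ⟨hA₃, hB₃⟩ := sum_choose_succ (by omega) hA₂ hB₂
    obtain ⟨hA₄, hB₄⟩ := sum_choose_succ (by omega) hA₃ hB₃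
    rw [show 4 * (m + 1) = 4 * m + 1 + 1 + 1 + 1 by ring, hA₄, hB₄]
    constructor <;> ring

end AlternatingChoose

lemma sum_choose_four_mul_div_eq {p n : ℕ} [Fact p.Prime] (hpn : p = 2 * n + 1) :
    ∑ k ∈ Finset.range (p / 4 + 1),
        (Nat.choose (4 * k) (2 * k) : ZMod p) / (-16 : ZMod p) ^ k =
      ∑ k ∈ Finset.range (n / 2 + 1), (n.choose (2 * k) : ZMod p) * (-1) ^ k := by
  have h2 : (2 : ZMod p) ≠ 0 := by
    intro h
    have h' : ((2 : ℕ) : ZMod p) = 0 := by exact_mod_cast h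
    rw [ZMod.natCast_eq_zero_iff] at h'
    have := Nat.le_of_dvd two_pos h'
    have := (Fact.out : p.Prime).two_le
    omega
  have h16 : (-16 : ZMod p) ≠ 0 := by
    rw [show (-16 : ZMod p) = -2 ^ 4 by norm_num]
    exact neg_ne_zero.mpr (pow_ne_zero _ h2)
  rw [show p / 4 = n / 2 by omega]
  refine Finset.sum_congr rfl fun k hk => ?_
  have hk' : 2 * k ≤ n := by
    have := Finset.mem_range.mp hk
    omega
  have h := centralBinom_eq_choose_mul_neg_four_pow hpn (2 * k) hk'
  rw [Nat.centralBinom, show 2 * (2 * k) = 4 * k by ring] at h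
  rw [h, div_eq_iff (pow_ne_zero _ h16), mul_assoc, ← mul_pow, pow_mul]
  norm_num


theorem stmt4 (p : ℕ) [Fact p.Prime] (hp : 5 < p) :
    (p % 8 = 1 →
      (∑ k ∈ Finset.range (p / 4 + 1),
          (Nat.choose (4 * k) (2 * k) : ZMod p) / (-16 : ZMod p) ^ k)
        = (-1 : ZMod p) ^ ((p - 1) / 8) * 2 ^ ((p - 1) / 4)) ∧
    (p % 8 = 3 →
      (∑ k ∈ Finset.range (p / 4 + 1),
          (Nat.choose (4 * k) (2 * k) : ZMod p) / (-16 : ZMod p) ^ k)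
        = (-1 : ZMod p) ^ ((p - 3) / 8) * 2 ^ ((p - 3) / 4)) ∧
    (p % 8 = 5 →
      (∑ k ∈ Finset.range (p / 4 + 1),
          (Nat.choose (4 * k) (2 * k) : ZMod p) / (-16 : ZMod p) ^ k) = 0) ∧
    (p % 8 = 7 →
      (∑ k ∈ Finset.range (p / 4 + 1),
          (Nat.choose (4 * k) (2 * k) : ZMod p) / (-16 : ZMod p) ^ k)
        = (-1 : ZMod p) ^ ((p + 1) / 8) * 2 ^ ((p - 3) / 4)) := by
  have neg_four_pow (m : ℕ) : (-4 : ZMod p) ^ m = (-1) ^ m * 2 ^ (2 * m) := by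
    rw [pow_mul, ← mul_pow]
    norm_num
  refine ⟨fun h => ?_, fun h => ?_, fun h => ?_, fun h => ?_⟩
  · obtain ⟨m, rfl⟩ : ∃ m, p = 8 * m + 1 := ⟨p / 8, by omega⟩
    rw [sum_choose_four_mul_div_eq (n := 4 * m) (by ring),
      (sum_choose_four_mul m _ (by omega)).1, neg_four_pow]
    congr 2 <;> omega
  · obtain ⟨m, rfl⟩ : ∃ m, p = 8 * m + 3 := ⟨p / 8, by omega⟩
    obtain ⟨hA, hB⟩ := sum_choose_four_mul (R := ZMod (8 * m + 3)) m ((4 * m + 1) / 2) (by omega)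
    rw [sum_choose_four_mul_div_eq (n := 4 * m + 1) (by ring), sum_choose_even_succ (by omega),
      hA, hB, sub_zero, neg_four_pow]
    congr 2 <;> omega
  · obtain ⟨m, rfl⟩ : ∃ m, p = 8 * m + 5 := ⟨p / 8, by omega⟩
    obtain ⟨hA, hB⟩ :=
      sum_choose_four_mul (R := ZMod (8 * m + 5)) m ((4 * m + 1 + 1) / 2) (by omega)
    rw [sum_choose_four_mul_div_eq (n := 4 * m + 1 + 1) (by ring),
      sum_choose_even_succ (by omega), sum_choose_even_succ (by omega), sum_choose_odd_succ,
      hA, hB]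
    ring
  · obtain ⟨m, rfl⟩ : ∃ m, p = 8 * m + 7 := ⟨p / 8, by omega⟩
    obtain ⟨hA, hB⟩ :=
      sum_choose_four_mul (R := ZMod (8 * m + 7)) m ((4 * m + 1 + 1 + 1) / 2) (by omega)
    obtain ⟨hA₁, hB₁⟩ := sum_choose_succ (n := 4 * m) (by omega) hA hB
    obtain ⟨hA₂, hB₂⟩ := sum_choose_succ (by omega) hA₁ hB₁
    rw [sum_choose_four_mul_div_eq (n := 4 * m + 1 + 1 + 1) (by ring),
      (sum_choose_succ (by omega) hA₂ hB₂).1, neg_four_pow,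
      show (8 * m + 7 + 1) / 8 = m + 1 by omega,
      show (8 * m + 7 - 3) / 4 = 2 * m + 1 by omega]
    ring
end

section
/- Let p be an odd prime with p ≠ 17. (i) If p ≡ 1 (mod 4), then ∑_{k=0}^{⌊p/4⌋} (−1)^k·C(4k,2k) ≡ 0 (mod p) if p ≡ ±3, ±5, ±6, ±7 (mod 17); ≡ 17^{(p−1)/4} (mod p) if p ≡ ±1, ±4 (mod 17); and ≡ −17^{(p−1)/4} (mod p) if p ≡ ±2, ±8 (mod 17). (ii) If p ≡ 3 (mod 4), then ∑_{k=0}^{⌊p/4⌋} (−1)^k·C(4k,2k) ≡ 17^{(p−3)/4} (mod p) if p ≡ ±1, ±4 (mod 17); ≡ −17^{(p−3)/4} (mod p) if p ≡ ±2, ±8 (mod 17); ≡ 4·17^{(p−3)/4} (mod p) if p ≡ ±3, ±5 (mod 17); and ≡ −4·17^{(p−3)/4} (mod p) if p ≡ ±6, ±7 (mod 17). -/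
/-- The Gauss sum of the quartic character modulo `17` taking the generator `3` to `I`,
formed with the `17`-th root of unity `z`. -/
def quarticGaussSum {R : Type*} [CommRing R] (I z : R) : R :=
  (z + z ^ 13 + z ^ 16 + z ^ 4) + I * (z ^ 3 + z ^ 5 + z ^ 14 + z ^ 12)
    - (z ^ 9 + z ^ 15 + z ^ 8 + z ^ 2) - I * (z ^ 10 + z ^ 11 + z ^ 7 + z ^ 6)

/-- The Gauss sum of the quadratic character modulo `17`,
formed with the `17`-th root of unity `z`. -/
def quadraticGaussSum {R : Type*} [CommRing R] (z : R) : R :=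
  (z + z ^ 13 + z ^ 16 + z ^ 4) - (z ^ 3 + z ^ 5 + z ^ 14 + z ^ 12)
    + (z ^ 9 + z ^ 15 + z ^ 8 + z ^ 2) - (z ^ 10 + z ^ 11 + z ^ 7 + z ^ 6)

section GaussSum

variable {R : Type*} [CommRing R] {I z : R}

lemma quarticGaussSum_pow_three (hI : I ^ 2 + 1 = 0) (hz : z ^ 17 - 1 = 0) :
    quarticGaussSum I (z ^ 3) = -I * quarticGaussSum I z := by
  unfold quarticGaussSum
  linear_combination
    (z ^ 14 + z ^ 12 - z ^ 11 - z ^ 10 - z ^ 7 - z ^ 6 + z ^ 5 + z ^ 3) * hI + (z ^ 31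
      - z ^ 28 + z ^ 22 + z ^ 14 - z ^ 11 - z ^ 10 - z ^ 7 + z ^ 5 + I * (z ^ 25 + z ^ 19
      - z ^ 16 - z ^ 13 + z ^ 8 - z ^ 4 + z ^ 2 - z)) * hz

lemma quadraticGaussSum_sq (hz : ∑ i ∈ Finset.range 17, z ^ i = 0) :
    quadraticGaussSum z ^ 2 = 17 := by
  simp only [Finset.sum_range_succ, Finset.sum_range_zero] at hz
  unfold quadraticGaussSum
  linear_combination
    (z ^ 16 + z ^ 15 - 3 * z ^ 14 + z ^ 13 + z ^ 12 - 7 * z ^ 11 + 5 * z ^ 10 + z ^ 9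
      + 5 * z ^ 8 - 7 * z ^ 7 + z ^ 6 + z ^ 5 - 3 * z ^ 4 + z ^ 3 + z ^ 2 + 17 * z - 17) * hz

lemma quarticGaussSum_sq (hI : I ^ 2 + 1 = 0) (hz : ∑ i ∈ Finset.range 17, z ^ i = 0) :
    quarticGaussSum I z ^ 2 = -(1 - 4 * I) * quadraticGaussSum z := by
  simp only [Finset.sum_range_succ, Finset.sum_range_zero] at hz
  unfold quarticGaussSum quadraticGaussSum
  linear_combination
    (z ^ 28 + 2 * z ^ 26 - 2 * z ^ 25 - z ^ 24 - 2 * z ^ 23 - z ^ 22 - z ^ 20 + 8 * z ^ 17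
      - z ^ 14 - z ^ 12 - 2 * z ^ 11 - z ^ 10 - 2 * z ^ 9 + 2 * z ^ 8 + z ^ 6) * hI + (z ^ 16
      - 3 * z ^ 15 + 3 * z ^ 14 + z ^ 13 - 5 * z ^ 12 + 3 * z ^ 11 - z ^ 10 + z ^ 9 + z ^ 8
      + 3 * z ^ 7 - 5 * z ^ 6 - z ^ 5 + 5 * z ^ 4 - 5 * z ^ 3 + z ^ 2 + z + I * (2 * z ^ 14
      - 4 * z ^ 13 + 4 * z ^ 12 - 4 * z ^ 11 + 2 * z ^ 10 + 4 * z ^ 9 - 6 * z ^ 8 - 4 * z ^ 7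
      + 4 * z ^ 6 + 4 * z ^ 5 - 6 * z ^ 4 + 8 * z ^ 3 - 4 * z)) * hz

lemma quarticGaussSum_mul_neg (hI : I ^ 2 + 1 = 0) (hz : ∑ i ∈ Finset.range 17, z ^ i = 0) :
    quarticGaussSum I z * quarticGaussSum (-I) z = 17 := by
  simp only [Finset.sum_range_succ, Finset.sum_range_zero] at hz
  unfold quarticGaussSum
  linear_combination
    (-z ^ 28 - 2 * z ^ 26 + 2 * z ^ 25 + z ^ 24 + 2 * z ^ 23 + z ^ 22 + z ^ 20 - 8 * z ^ 17
      + z ^ 14 + z ^ 12 + 2 * z ^ 11 + z ^ 10 + 2 * z ^ 9 - 2 * z ^ 8 - z ^ 6) * hI + (z ^ 16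
      - 3 * z ^ 15 + 3 * z ^ 14 + z ^ 13 - 3 * z ^ 12 + z ^ 11 + 3 * z ^ 10 - 7 * z ^ 9
      + 3 * z ^ 8 + z ^ 7 - 3 * z ^ 6 + z ^ 5 + 3 * z ^ 4 - 3 * z ^ 3 + z ^ 2 + 17 * z - 17) *
      hz

lemma quarticGaussSum_pow_four (hI : I ^ 2 + 1 = 0) (hz : ∑ i ∈ Finset.range 17, z ^ i = 0) :
    quarticGaussSum I z ^ 4 = 17 * (1 - 4 * I) ^ 2 := by
  rw [← quadraticGaussSum_sq hz, show 4 = 2 * 2 from rfl, pow_mul, quarticGaussSum_sq hI hz]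
  ring

lemma quarticGaussSum_pow_three_pow (hI : I ^ 2 + 1 = 0) (hz : z ^ 17 = 1) (j : ℕ) :
    quarticGaussSum I (z ^ 3 ^ j) = (-I) ^ j * quarticGaussSum I z := by
  induction j with
  | zero => simp
  | succ j ih =>
    have h : (z ^ 3 ^ j) ^ 17 - 1 = 0 := by rw [← pow_mul, mul_comm, pow_mul, hz, one_pow, sub_self]
    rw [pow_succ 3, pow_mul, quarticGaussSum_pow_three hI h, ih]
    ring

lemma pow_eq_one_of_geom_sum_eq_zero {n : ℕ} (hz : ∑ i ∈ Finset.range n, z ^ i = 0) :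
    z ^ n = 1 := by
  rw [← sub_eq_zero, ← geom_sum_mul, hz, zero_mul]

lemma quarticGaussSum_pow_char (p : ℕ) [Fact p.Prime] [CharP R p] :
    quarticGaussSum I z ^ p = quarticGaussSum (I ^ p) (z ^ p) := by
  unfold quarticGaussSum
  simp only [← frobenius_def, map_add, map_sub, map_mul, map_pow]

lemma one_sub_four_mul_pow_char (p : ℕ) [Fact p.Prime] [CharP R p] :
    (1 - 4 * I) ^ p = 1 - 4 * I ^ p := by
  simp only [← frobenius_def, map_sub, map_one, map_mul, map_ofNat]

lemma quarticGaussSum_pow_char_of_mod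
    (hz : ∑ i ∈ Finset.range 17, z ^ i = 0) {p j : ℕ} [Fact p.Prime] [CharP R p]
    (hj : p % 17 = 3 ^ j % 17) (hIp : (I ^ p) ^ 2 + 1 = 0) :
    quarticGaussSum I z ^ p = (-I ^ p) ^ j * quarticGaussSum (I ^ p) z := by
  have hz17 := pow_eq_one_of_geom_sum_eq_zero hz
  rw [quarticGaussSum_pow_char p, pow_eq_pow_mod p hz17, hj, ← pow_eq_pow_mod _ hz17,
    quarticGaussSum_pow_three_pow hIp hz17]

lemma pow_four_mul_add_one (hI : I ^ 2 + 1 = 0) (q : ℕ) : I ^ (4 * q + 1) = I := by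
  have h : I ^ 4 = 1 := by linear_combination (I ^ 2 - 1) * hI
  rw [pow_succ, pow_mul, h, one_pow, one_mul]

lemma pow_four_mul_add_three (hI : I ^ 2 + 1 = 0) (q : ℕ) : I ^ (4 * q + 3) = -I := by
  rw [show 4 * q + 3 = 4 * q + 1 + 2 by ring, pow_add, pow_four_mul_add_one hI]
  linear_combination I * hI

end GaussSum

section Field

variable {K : Type*} [Field K] {I z : K} {p q j : ℕ} [CharP K p]

lemma one_sub_pow_of_mod_four_eq_one [Fact p.Prime]
    (hI : I ^ 2 + 1 = 0) (hz : ∑ i ∈ Finset.range 17, z ^ i = 0) (h17 : (17 : K) ≠ 0)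
    (hp : p = 4 * q + 1)
    (hj : p % 17 = 3 ^ j % 17) :
    17 ^ q * (1 - 4 * I) ^ (2 * q) = (-I) ^ j := by
  have hIp : I ^ p = I := hp ▸ pow_four_mul_add_one hI q
  have hG := quarticGaussSum_pow_char_of_mod hz hj (by rwa [hIp])
  have hG0 : quarticGaussSum I z ≠ 0 :=
    left_ne_zero_of_mul (quarticGaussSum_mul_neg hI hz ▸ h17)
  rw [hIp] at hG
  nth_rewrite 1 [hp] at hG
  rw [pow_succ, pow_mul, quarticGaussSum_pow_four hI hz, mul_pow, ← pow_mul] at hG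
  exact mul_right_cancel₀ hG0 hG

lemma one_sub_pow_of_mod_four_eq_three [Fact p.Prime]
    (hI : I ^ 2 + 1 = 0) (hz : ∑ i ∈ Finset.range 17, z ^ i = 0) (h17 : (17 : K) ≠ 0)
    (hp : p = 4 * q + 3)
    (hj : p % 17 = 3 ^ j % 17) :
    17 ^ q * (1 - 4 * I) ^ (2 * q + 2) = I ^ j := by
  have hIp : I ^ p = -I := hp ▸ pow_four_mul_add_three hI q
  have hG := quarticGaussSum_pow_char_of_mod hz hj (by rwa [hIp, neg_sq])
  have hGG := quarticGaussSum_mul_neg hI hz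
  rw [hIp, neg_neg] at hG
  have h : quarticGaussSum I z ^ p * quarticGaussSum I z
      = 17 ^ (q + 1) * (1 - 4 * I) ^ (2 * q + 2) := by
    rw [hp, ← pow_succ, show 4 * q + 3 + 1 = 4 * (q + 1) by ring, pow_mul,
      quarticGaussSum_pow_four hI hz, mul_pow, ← pow_mul, mul_add_one]
  apply mul_left_cancel₀ h17
  linear_combination I ^ j * hGG - h + quarticGaussSum I z * hG

lemma choose_eq_centralBinom {m : ℕ} (hp : p = 2 * m + 1) {n : ℕ} (hn : n ≤ m) :
    (m.choose n : K) * (-4) ^ n = n.centralBinom := by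
  induction n with
  | zero => simp
  | succ n ih =>
    have h0 : ((n + 1 : ℕ) : K) ≠ 0 := by
      rw [Ne, CharP.cast_eq_zero_iff K p]
      exact Nat.not_dvd_of_pos_of_lt n.succ_pos (by omega)
    have hm : 2 * (m : K) + 1 = 0 := by
      have := CharP.cast_eq_zero K p
      rw [hp] at this
      exact_mod_cast this
    have h1 := congrArg (Nat.cast : ℕ → K) (Nat.succ_mul_centralBinom_succ n)
    have h2 := congrArg (Nat.cast : ℕ → K) (Nat.choose_succ_right_eq m n)
    apply mul_left_cancel₀ h0
    push_cast [Nat.cast_sub (show n ≤ m by omega)] at h1 h2 ⊢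
    linear_combination (-4) ^ (n + 1) * h2 - h1 - 4 * (m - n) * ih (by omega)
      + (2 * n.centralBinom) * (-hm)

lemma one_sub_four_mul_pow_eq_sum_centralBinom {m : ℕ} (hp : p = 2 * m + 1) (x : K) :
    (1 - 4 * x) ^ m = ∑ n ∈ Finset.range (m + 1), (n.centralBinom : K) * x ^ n := by
  rw [sub_eq_add_neg, add_comm, add_pow]
  refine Finset.sum_congr rfl fun n hn => ?_
  rw [← choose_eq_centralBinom hp (Nat.lt_succ_iff.mp (Finset.mem_range.mp hn)), one_pow,
    ← neg_mul, mul_pow]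
  ring

lemma sum_range_two_mul_pow_add_neg_pow {R : Type*} [CommRing R] {I : R} (hI : I ^ 2 + 1 = 0)
    (a : ℕ → R) (n : ℕ) :
    ∑ k ∈ Finset.range (2 * n), (a k * I ^ k + a k * (-I) ^ k)
      = 2 * ∑ k ∈ Finset.range n, (-1) ^ k * a (2 * k) := by
  have h : I ^ 2 = -1 := by linear_combination hI
  induction n with
  | zero => simp
  | succ n ih =>
    rw [mul_add_one, Finset.sum_range_succ, Finset.sum_range_succ, ih, Finset.sum_range_succ]
    simp only [pow_succ _ (2 * n), pow_mul, neg_sq, h]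
    ring

lemma two_mul_sum_choose_eq {m : ℕ} (hI : I ^ 2 + 1 = 0) (hp : p = 2 * m + 1) :
    2 * ∑ k ∈ Finset.range (p / 4 + 1), (-1 : K) ^ k * (Nat.choose (4 * k) (2 * k) : K)
      = (1 - 4 * I) ^ m + (1 + 4 * I) ^ m := by
  have hc (k : ℕ) : (Nat.choose (4 * k) (2 * k) : K) = ((2 * k).centralBinom : K) := by
    rw [Nat.centralBinom, ← mul_assoc]; norm_num
  have hneg : (1 + 4 * I) = 1 - 4 * (-I) := by ring
  rw [hneg, one_sub_four_mul_pow_eq_sum_centralBinom hp, one_sub_four_mul_pow_eq_sum_centralBinom hp,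
    ← Finset.sum_add_distrib]
  simp only [hc]
  rw [← sum_range_two_mul_pow_add_neg_pow hI (fun k => (k.centralBinom : K))]
  obtain ⟨q, rfl | rfl⟩ := m.even_or_odd'
  · rw [show p / 4 = q by omega, mul_add_one, Finset.sum_range_succ]
    simp [pow_succ, pow_mul]
  · rw [show p / 4 = q by omega, mul_add_one]

lemma two_mul_sum_choose_of_mod_four_eq_one [Fact p.Prime]
    (hI : I ^ 2 + 1 = 0) (hz : ∑ i ∈ Finset.range 17, z ^ i = 0) (h17 : (17 : K) ≠ 0)
    (hp : p = 4 * q + 1)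
    (hj : p % 17 = 3 ^ j % 17) :
    2 * ∑ k ∈ Finset.range (p / 4 + 1), (-1 : K) ^ k * (Nat.choose (4 * k) (2 * k) : K)
      = (-1) ^ j * 17 ^ q * (I ^ j + (-I) ^ j) := by
  have hI' : (-I) ^ 2 + 1 = 0 := by rwa [neg_sq]
  have hB := one_sub_pow_of_mod_four_eq_one hI hz h17 hp hj
  have hA := one_sub_pow_of_mod_four_eq_one hI' hz h17 hp hj
  rw [neg_neg, mul_neg, sub_neg_eq_add] at hA
  have hAB : (1 - 4 * I) * (1 + 4 * I) = 17 := by linear_combination -16 * hI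
  have hB1 : (1 - 4 * I) ^ (4 * q) = 1 := by
    have h := one_sub_four_mul_pow_char (I := I) p
    rw [hp, pow_four_mul_add_one hI, pow_succ] at h
    exact mul_right_cancel₀ (left_ne_zero_of_mul (hAB ▸ h17)) (h.trans (one_mul _).symm)
  have hsq : (17 : K) ^ q * 17 ^ q = (-1) ^ j := by
    have hI2 : I ^ 2 = -1 := by linear_combination hI
    calc (17 : K) ^ q * 17 ^ q
        = (17 ^ q * (1 - 4 * I) ^ (2 * q)) ^ 2 := by
          rw [mul_pow, ← pow_mul (1 - 4 * I), show 2 * q * 2 = 4 * q by ring, hB1]; ring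
      _ = (-1) ^ j := by rw [hB, pow_right_comm, neg_sq, hI2]
  rw [two_mul_sum_choose_eq (m := 2 * q) hI (by omega)]
  apply mul_left_cancel₀ (pow_ne_zero q h17)
  have hj2 : ((-1 : K) ^ j) * (-1) ^ j = 1 := by rw [← mul_pow]; simp
  linear_combination hA + hB - ((-1) ^ j * (I ^ j + (-I) ^ j)) * hsq - (I ^ j + (-I) ^ j) * hj2

lemma two_mul_sum_choose_of_mod_four_eq_three [Fact p.Prime]
    (hI : I ^ 2 + 1 = 0) (hz : ∑ i ∈ Finset.range 17, z ^ i = 0) (h17 : (17 : K) ≠ 0)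
    (hp : p = 4 * q + 3)
    (hj : p % 17 = 3 ^ j % 17) :
    2 * ∑ k ∈ Finset.range (p / 4 + 1), (-1 : K) ^ k * (Nat.choose (4 * k) (2 * k) : K)
      = (-1) ^ j * 17 ^ q * ((1 + 4 * I) * I ^ j + (1 - 4 * I) * (-I) ^ j) := by
  have hI' : (-I) ^ 2 + 1 = 0 := by rwa [neg_sq]
  have hB := one_sub_pow_of_mod_four_eq_three hI hz h17 hp hj
  have hA := one_sub_pow_of_mod_four_eq_three hI' hz h17 hp hj
  rw [mul_neg, sub_neg_eq_add] at hA
  have hAB : (1 - 4 * I) * (1 + 4 * I) = 17 := by linear_combination -16 * hI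
  have hB1 : (1 - 4 * I) ^ (4 * q + 4) = 17 := by
    have h := one_sub_four_mul_pow_char (I := I) p
    rw [hp, pow_four_mul_add_three hI, mul_neg, sub_neg_eq_add] at h
    rw [pow_succ, h, mul_comm, hAB]
  have hsq : (17 : K) ^ q * 17 ^ q * 17 = (-1) ^ j := by
    have hI2 : I ^ 2 = -1 := by linear_combination hI
    calc (17 : K) ^ q * 17 ^ q * 17
        = (17 ^ q * (1 - 4 * I) ^ (2 * q + 2)) ^ 2 := by
          rw [mul_pow, ← pow_mul (1 - 4 * I), show (2 * q + 2) * 2 = 4 * q + 4 by ring, hB1]; ring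
      _ = (-1) ^ j := by rw [hB, pow_right_comm, hI2]
  rw [two_mul_sum_choose_eq (m := 2 * q + 1) hI (by omega)]
  apply mul_left_cancel₀ (mul_ne_zero (pow_ne_zero q h17) h17)
  have hj2 : ((-1 : K) ^ j) * (-1) ^ j = 1 := by rw [← mul_pow]; simp
  set c := (1 + 4 * I) * I ^ j + (1 - 4 * I) * (-I) ^ j with hc
  linear_combination (1 - 4 * I) * hA + (1 + 4 * I) * hB
    - (17 ^ q * ((1 - 4 * I) ^ (2 * q + 1) + (1 + 4 * I) ^ (2 * q + 1))) * hAB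
    - ((-1) ^ j * c) * hsq - c * hj2 - hc

end Field

lemma exists_sq_add_one_and_geom_sum_eq_zero (K : Type*) [Field K] [IsAlgClosed K] :
    ∃ I z : K, I ^ 2 + 1 = 0 ∧ ∑ i ∈ Finset.range 17, z ^ i = 0 := by
  obtain ⟨I, hI⟩ := IsAlgClosed.exists_pow_nat_eq (-1 : K) two_pos
  obtain ⟨z, hz⟩ := IsAlgClosed.exists_root (Polynomial.cyclotomic 17 K)
    (by rw [Polynomial.degree_cyclotomic]; decide)
  have : Fact (Nat.Prime 17) := ⟨by norm_num⟩
  rw [Polynomial.cyclotomic_prime, Polynomial.IsRoot, Polynomial.eval_geom_sum] at hz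
  exact ⟨I, z, by rw [hI, neg_add_cancel], hz⟩

section Descent

variable {p : ℕ} [Fact p.Prime]

lemma eq_mul_pow_of_two_mul_algebraMap_eq (hp2 : p ≠ 2) {K : Type*} [Field K] [Algebra (ZMod p) K]
    {s : ZMod p} {c : ℤ} {q : ℕ} (h : 2 * algebraMap (ZMod p) K s = 17 ^ q * (2 * c)) :
    s = c * 17 ^ q := by
  have h2 : (2 : ZMod p) ≠ 0 := Ring.two_ne_zero (by rwa [ZMod.ringChar_zmod_n])
  apply mul_left_cancel₀ h2
  apply (algebraMap (ZMod p) K).injective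
  simp only [map_mul, map_pow, map_ofNat, map_intCast]
  linear_combination h

lemma seventeen_ne_zero (hp17 : p ≠ 17) (K : Type*) [Field K] [CharP K p] : (17 : K) ≠ 0 := by
  rw [← Nat.cast_ofNat, Ne, CharP.cast_eq_zero_iff K p,
    Nat.prime_dvd_prime_iff_eq Fact.out (by norm_num)]
  exact hp17

lemma sum_choose_eq_of_mod_four_eq_one (hp2 : p ≠ 2) (hp17 : p ≠ 17) (hp : p % 4 = 1) {t : ℕ}
    (ht : ∃ i < 4, p % 17 = 3 ^ (4 * i + t) % 17) (c : ℤ)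
    (hc : ∀ {K : Type} [Field K] (I : K), I ^ 2 + 1 = 0 →
      (-1) ^ t * (I ^ t + (-I) ^ t) = 2 * (c : K)) :
    ∑ k ∈ Finset.range (p / 4 + 1), (-1 : ZMod p) ^ k * (Nat.choose (4 * k) (2 * k) : ZMod p)
      = c * 17 ^ ((p - 1) / 4) := by
  obtain ⟨i, -, hi⟩ := ht
  let K := AlgebraicClosure (ZMod p)
  have : CharP K p := charP_of_injective_algebraMap (algebraMap (ZMod p) K).injective p
  obtain ⟨I, z, hI, hz⟩ := exists_sq_add_one_and_geom_sum_eq_zero K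
  have h := two_mul_sum_choose_of_mod_four_eq_one hI hz (seventeen_ne_zero hp17 K)
    (q := (p - 1) / 4) (by omega) hi
  have hI4 : I ^ 4 = 1 := by linear_combination (I ^ 2 - 1) * hI
  apply eq_mul_pow_of_two_mul_algebraMap_eq (K := K) hp2
  rw [← hc I hI]
  simp only [pow_add, pow_mul, (by decide : Even 4).neg_pow, hI4, one_pow, one_mul] at h
  simp only [map_sum, map_mul, map_pow, map_neg, map_one, map_natCast]
  linear_combination h

lemma sum_choose_eq_of_mod_four_eq_three (hp17 : p ≠ 17) (hp : p % 4 = 3) {t : ℕ}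
    (ht : ∃ i < 4, p % 17 = 3 ^ (4 * i + t) % 17) (c : ℤ)
    (hc : ∀ {K : Type} [Field K] (I : K), I ^ 2 + 1 = 0 →
      (-1) ^ t * ((1 + 4 * I) * I ^ t + (1 - 4 * I) * (-I) ^ t) = 2 * (c : K)) :
    ∑ k ∈ Finset.range (p / 4 + 1), (-1 : ZMod p) ^ k * (Nat.choose (4 * k) (2 * k) : ZMod p)
      = c * 17 ^ ((p - 3) / 4) := by
  obtain ⟨i, -, hi⟩ := ht
  let K := AlgebraicClosure (ZMod p)
  have : CharP K p := charP_of_injective_algebraMap (algebraMap (ZMod p) K).injective p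
  obtain ⟨I, z, hI, hz⟩ := exists_sq_add_one_and_geom_sum_eq_zero K
  have h := two_mul_sum_choose_of_mod_four_eq_three hI hz (seventeen_ne_zero hp17 K)
    (q := (p - 3) / 4) (by omega) hi
  have hI4 : I ^ 4 = 1 := by linear_combination (I ^ 2 - 1) * hI
  apply eq_mul_pow_of_two_mul_algebraMap_eq (K := K) (by omega)
  rw [← hc I hI]
  simp only [pow_add, pow_mul, (by decide : Even 4).neg_pow, hI4, one_pow, one_mul] at h
  simp only [map_sum, map_mul, map_pow, map_neg, map_one, map_natCast]
  linear_combination h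

end Descent

theorem stmt6 (p : ℕ) [Fact p.Prime] (hp2 : p ≠ 2) (hp17 : p ≠ 17) :
    (p % 4 = 1 →
      ((p % 17 = 3 ∨ p % 17 = 5 ∨ p % 17 = 6 ∨ p % 17 = 7 ∨
        p % 17 = 10 ∨ p % 17 = 11 ∨ p % 17 = 12 ∨ p % 17 = 14 →
        (∑ k ∈ Finset.range (p / 4 + 1),
            (-1 : ZMod p) ^ k * (Nat.choose (4 * k) (2 * k) : ZMod p)) = 0) ∧
      (p % 17 = 1 ∨ p % 17 = 4 ∨ p % 17 = 13 ∨ p % 17 = 16 →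
        (∑ k ∈ Finset.range (p / 4 + 1),
            (-1 : ZMod p) ^ k * (Nat.choose (4 * k) (2 * k) : ZMod p))
          = 17 ^ ((p - 1) / 4)) ∧
      (p % 17 = 2 ∨ p % 17 = 8 ∨ p % 17 = 9 ∨ p % 17 = 15 →
        (∑ k ∈ Finset.range (p / 4 + 1),
            (-1 : ZMod p) ^ k * (Nat.choose (4 * k) (2 * k) : ZMod p))
          = -17 ^ ((p - 1) / 4)))) ∧
    (p % 4 = 3 →
      ((p % 17 = 1 ∨ p % 17 = 4 ∨ p % 17 = 13 ∨ p % 17 = 16 →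
        (∑ k ∈ Finset.range (p / 4 + 1),
            (-1 : ZMod p) ^ k * (Nat.choose (4 * k) (2 * k) : ZMod p))
          = 17 ^ ((p - 3) / 4)) ∧
      (p % 17 = 2 ∨ p % 17 = 8 ∨ p % 17 = 9 ∨ p % 17 = 15 →
        (∑ k ∈ Finset.range (p / 4 + 1),
            (-1 : ZMod p) ^ k * (Nat.choose (4 * k) (2 * k) : ZMod p))
          = -17 ^ ((p - 3) / 4)) ∧
      (p % 17 = 3 ∨ p % 17 = 5 ∨ p % 17 = 12 ∨ p % 17 = 14 →
        (∑ k ∈ Finset.range (p / 4 + 1),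
            (-1 : ZMod p) ^ k * (Nat.choose (4 * k) (2 * k) : ZMod p))
          = 4 * 17 ^ ((p - 3) / 4)) ∧
      (p % 17 = 6 ∨ p % 17 = 7 ∨ p % 17 = 10 ∨ p % 17 = 11 →
        (∑ k ∈ Finset.range (p / 4 + 1),
            (-1 : ZMod p) ^ k * (Nat.choose (4 * k) (2 * k) : ZMod p))
          = -4 * 17 ^ ((p - 3) / 4)))) := by
  refine ⟨fun hp => ⟨fun h => ?_, fun h => ?_, fun h => ?_⟩,
    fun hp => ⟨fun h => ?_, fun h => ?_, fun h => ?_, fun h => ?_⟩⟩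
  · obtain h | h : (∃ i < 4, p % 17 = 3 ^ (4 * i + 1) % 17) ∨
        ∃ i < 4, p % 17 = 3 ^ (4 * i + 3) % 17 := by
      rcases h with h | h | h | h | h | h | h | h <;> rw [h] <;> decide
    · simpa using sum_choose_eq_of_mod_four_eq_one hp2 hp17 hp h 0
        fun I hI => by push_cast; ring
    · simpa using sum_choose_eq_of_mod_four_eq_one hp2 hp17 hp h 0
        fun I hI => by push_cast; ring
  · have h : ∃ i < 4, p % 17 = 3 ^ (4 * i + 0) % 17 := by
      rcases h with h | h | h | h <;> rw [h] <;> decide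
    simpa using sum_choose_eq_of_mod_four_eq_one hp2 hp17 hp h 1
      fun I hI => by push_cast; ring
  · have h : ∃ i < 4, p % 17 = 3 ^ (4 * i + 2) % 17 := by
      rcases h with h | h | h | h <;> rw [h] <;> decide
    simpa using sum_choose_eq_of_mod_four_eq_one hp2 hp17 hp h (-1)
      fun I hI => by push_cast; linear_combination 2 * hI
  · have h : ∃ i < 4, p % 17 = 3 ^ (4 * i + 0) % 17 := by
      rcases h with h | h | h | h <;> rw [h] <;> decide
    simpa using sum_choose_eq_of_mod_four_eq_three hp17 hp h 1
      fun I hI => by push_cast; ring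
  · have h : ∃ i < 4, p % 17 = 3 ^ (4 * i + 2) % 17 := by
      rcases h with h | h | h | h <;> rw [h] <;> decide
    simpa using sum_choose_eq_of_mod_four_eq_three hp17 hp h (-1)
      fun I hI => by push_cast; linear_combination 2 * hI
  · have h : ∃ i < 4, p % 17 = 3 ^ (4 * i + 1) % 17 := by
      rcases h with h | h | h | h <;> rw [h] <;> decide
    simpa using sum_choose_eq_of_mod_four_eq_three hp17 hp h 4
      fun I hI => by push_cast; linear_combination (-8) * hI
  · have h : ∃ i < 4, p % 17 = 3 ^ (4 * i + 3) % 17 := by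
      rcases h with h | h | h | h <;> rw [h] <;> decide
    simpa using sum_choose_eq_of_mod_four_eq_three hp17 hp h (-4)
      fun I hI => by push_cast; linear_combination (8 - 8 * I ^ 2) * hI
end
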